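/- Fix a finite alphabet A with at least two letters. For each n, consider the uniform distribution on the set of synchronizing deterministic complete n-state automata over A. Then the probability that such a random synchronizing automaton admits a synchronizing word of length at most (n−1)² tends to 1 as n → ∞ (i.e., Černý's conjecture holds with high probability). -/

import Mathlib

open Classical

/-- The action of a word on the states of a deterministic complete automaton:
`act δ w q` is the state reached from `q` after reading the word `w`
(first letter applied first, so that `δ_{wa} = δ_a ∘ δ_w`). -/
def act {n : ℕ} {A : Type*} (δ : Fin n → A → Fin n) : List A → Fin n → Fin n
  | [], q => q
  | c :: w, q => act δ w (δ q c)

/-- A word `w` is synchronizing for `δ` if the induced action is a constant map. -/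
def IsSyncWord {n : ℕ} {A : Type*} (δ : Fin n → A → Fin n) (w : List A) : Prop :=
  ∃ r : Fin n, ∀ q : Fin n, act δ w q = r

/-- An automaton is synchronizing if it admits a synchronizing word. -/
def IsSynchronizing {n : ℕ} {A : Type*} (δ : Fin n → A → Fin n) : Prop :=
  ∃ w : List A, IsSyncWord δ w

theorem monotone_le_of_stabilizes {α : Type*} [PartialOrder α] (F : ℕ → α) (hF : Monotone F)
    (hstep : ∀ k, F k = F (k + 1) → F (k + 1) = F (k + 2)) (μ : α → ℕ) (hμ : StrictMono μ)
    (N : ℕ) (hN : ∀ k, μ (F k) ≤ N) (k : ℕ) : F k ≤ F N := by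
  obtain ⟨j, hjN, hj⟩ : ∃ j ≤ N, F j = F (j + 1) := by
    by_contra! h
    have key : ∀ i ≤ N + 1, i ≤ μ (F i) := by
      intro i
      induction i with
      | zero => simp
      | succ i ih =>
        intro hi
        have h1 : F i < F (i + 1) := lt_of_le_of_ne (hF (Nat.le_succ i)) (h i (by omega))
        have := hμ h1
        have := ih (by omega)
        omega
    have := key (N + 1) le_rfl
    have := hN (N + 1)
    omega
  have hst : ∀ i, F (j + i) = F (j + i + 1) := by
    intro i
    induction i with
    | zero => exact hj
    | succ i ih => exact hstep _ ih
  have hconst : ∀ i, F (j + i) = F j := by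
    intro i
    induction i with
    | zero => rfl
    | succ i ih => rw [← ih]; exact (hst i).symm
  calc F k ≤ F (j + k) := hF (by omega)
    _ = F j := hconst k
    _ ≤ F N := hF hjN

theorem act_eq_foldl {n : ℕ} {A : Type*} (δ : Fin n → A → Fin n) (w : List A) (q : Fin n) :
    act δ w q = w.foldl δ q := by
  induction w generalizing q with
  | nil => rfl
  | cons c w ih => exact ih _

theorem act_append {n : ℕ} {A : Type*} (δ : Fin n → A → Fin n) (u w : List A) (q : Fin n) :
    act δ (u ++ w) q = act δ w (act δ u q) := by
  simp [act_eq_foldl]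

/-- A linear functional vanishing on all translates of `g` by words of length at most `n`
vanishes on all translates of `g`. -/
theorem linear_eq_zero_of_short_words {n : ℕ} {A : Type*} (δ : Fin n → A → Fin n)
    (g : Fin n → ℝ) (φ : (Fin n → ℝ) →ₗ[ℝ] ℝ)
    (h : ∀ u : List A, u.length ≤ n → φ (g ∘ act δ u) = 0) (u : List A) :
    φ (g ∘ act δ u) = 0 := by
  let F : ℕ → Submodule ℝ (Fin n → ℝ) := fun k =>
    Submodule.span ℝ {f | ∃ u : List A, u.length ≤ k ∧ f = g ∘ act δ u}
  have hmono : Monotone F := fun i j hij =>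
    Submodule.span_mono fun f ⟨u, hu, hf⟩ => ⟨u, hu.trans hij, hf⟩
  let T : A → (Fin n → ℝ) →ₗ[ℝ] (Fin n → ℝ) := fun c => LinearMap.funLeft ℝ ℝ fun q => δ q c
  have hT : ∀ c (u : List A), T c (g ∘ act δ u) = g ∘ act δ (c :: u) := fun c u => rfl
  have hTF : ∀ k c f, f ∈ F k → T c f ∈ F (k + 1) := by
    intro k c f hf
    have : F k ≤ (F (k + 1)).comap (T c) := by
      refine Submodule.span_le.2 ?_
      rintro _ ⟨u, hu, rfl⟩
      exact Submodule.subset_span ⟨c :: u, by simpa using hu, hT c u⟩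
    exact this hf
  have hle : ∀ k, F k ≤ F n := by
    refine monotone_le_of_stabilizes F hmono ?_ (fun V => Module.finrank ℝ V)
      (fun V W h => Submodule.finrank_lt_finrank_of_lt h) n ?_
    · intro k hk
      refine le_antisymm (hmono (by omega)) (Submodule.span_le.2 ?_)
      rintro _ ⟨u, hu, rfl⟩
      cases u with
      | nil => exact Submodule.subset_span ⟨[], by simp, rfl⟩
      | cons c u =>
        rw [← hT]
        apply hTF
        rw [hk]
        exact Submodule.subset_span ⟨u, by simpa using hu, rfl⟩
    · intro k
      simpa using Submodule.finrank_le (F k)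
  have hker : F n ≤ LinearMap.ker φ := by
    refine Submodule.span_le.2 ?_
    rintro _ ⟨u, hu, rfl⟩
    exact h u hu
  exact hker (hle u.length (Submodule.subset_span ⟨u, le_rfl, rfl⟩))

/-- In a synchronizing automaton with `r` states, every pair of states is merged by a word of
length at most `r ^ 2`. -/
theorem exists_short_merging_word {W B : Type*} [Fintype W] (s : W → B → W)
    (hs : ∃ l : List B, ∀ p q, l.foldl s p = l.foldl s q) (p q : W) :
    ∃ l : List B, l.length ≤ Fintype.card W ^ 2 ∧ l.foldl s p = l.foldl s q := by
  let F : ℕ → Finset (W × W) := fun k =>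
    Finset.univ.filter fun x => ∃ l : List B, l.length ≤ k ∧ l.foldl s x.1 = l.foldl s x.2
  have hF : ∀ k x, x ∈ F k ↔ ∃ l : List B, l.length ≤ k ∧ l.foldl s x.1 = l.foldl s x.2 := by
    intro k x
    simp [F]
  have hmono : Monotone F := by
    intro i j hij x hx
    obtain ⟨l, hl, h⟩ := (hF _ _).1 hx
    exact (hF _ _).2 ⟨l, hl.trans hij, h⟩
  obtain ⟨l, hl⟩ := hs
  have hle := monotone_le_of_stabilizes F hmono ?_ Finset.card
    (fun _ _ h => Finset.card_lt_card h) (Fintype.card W ^ 2) ?_ l.length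
  · exact (hF _ (p, q)).1 (hle ((hF _ (p, q)).2 ⟨l, le_rfl, hl p q⟩))
  · intro k hk
    refine le_antisymm (hmono (by omega)) ?_
    intro x hx
    obtain ⟨l, hl, h⟩ := (hF _ _).1 hx
    cases l with
    | nil => exact (hF _ _).2 ⟨[], by simp, h⟩
    | cons c l =>
      have h1 : (s x.1 c, s x.2 c) ∈ F (k + 1) := (hF _ _).2 ⟨l, by simpa using hl, h⟩
      rw [← hk] at h1
      obtain ⟨l', hl', h'⟩ := (hF _ _).1 h1
      exact (hF _ _).2 ⟨c :: l', by simpa using hl', h'⟩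
  · intro k
    refine (Finset.card_le_univ _).trans ?_
    simp [sq]

theorem exists_sync_word_of_cube {W B : Type*} [Fintype W] (s : W → B → W)
    (hs : ∃ l : List B, ∀ p q, l.foldl s p = l.foldl s q) :
    ∃ l : List B, l.length ≤ Fintype.card W ^ 3 ∧ ∀ p q, l.foldl s p = l.foldl s q := by
  have key : ∀ k, ∃ l : List B, l.length ≤ k * Fintype.card W ^ 2 ∧
      (Finset.univ.image fun p => l.foldl s p).card ≤ max 1 (Fintype.card W - k) := by
    intro k
    induction k with
    | zero => exact ⟨[], by simp, by simp⟩
    | succ k ih =>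
      obtain ⟨l, hl, hc⟩ := ih
      by_cases h : (Finset.univ.image fun p => l.foldl s p).card ≤ 1
      · exact ⟨l, hl.trans (by gcongr; omega), h.trans (le_max_left _ _)⟩
      · obtain ⟨p, hp, q, hq, hpq⟩ := Finset.one_lt_card.1 (not_le.1 h)
        obtain ⟨l', hl', h'⟩ := exists_short_merging_word s hs p q
        refine ⟨l ++ l', by rw [List.length_append, add_mul]; omega, ?_⟩
        have himg : (Finset.univ.image fun p => (l ++ l').foldl s p) =
            (Finset.univ.image fun p => l.foldl s p).image fun p => l'.foldl s p := by
          rw [Finset.image_image]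
          congr 1
          ext p
          simp
        have hlt : ((Finset.univ.image fun p => l.foldl s p).image fun p => l'.foldl s p).card
            < (Finset.univ.image fun p => l.foldl s p).card := by
          refine lt_of_le_of_ne Finset.card_image_le fun he => ?_
          exact hpq (Finset.card_image_iff.1 he hp hq h')
        rw [himg]
        omega
  obtain ⟨l, hl, hc⟩ := key (Fintype.card W)
  refine ⟨l, by rw [pow_succ']; exact hl, fun p q => ?_⟩
  rw [Nat.sub_self] at hc
  exact Finset.card_le_one.1 (hc.trans (by simp)) _ (Finset.mem_image_of_mem _ (Finset.mem_univ p))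
    _ (Finset.mem_image_of_mem _ (Finset.mem_univ q))

/-- A synchronizing automaton remains synchronizing when restricted to the image of a word `w`
and to the words `u ++ w` with `u` of length at most `n`. -/
theorem exists_sync_word_on_range {n : ℕ} {A : Type*} (δ : Fin n → A → Fin n)
    (hδ : IsSynchronizing δ) (w : List A)
    (s : Set.range (act δ w) → {u : List A // u.length ≤ n} → Set.range (act δ w))
    (hs : ∀ q u, (s q u : Fin n) = act δ w (act δ u q)) :
    ∃ l : List {u : List A // u.length ≤ n}, ∀ p q, l.foldl s p = l.foldl s q := by
  obtain ⟨x, r₀, hx⟩ := hδ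
  let I : List {u : List A // u.length ≤ n} → Finset (Set.range (act δ w)) := fun l =>
    Finset.univ.image fun p => l.foldl s p
  obtain ⟨t, ht⟩ : ∃ t, ∀ l, (I t).card ≤ (I l).card :=
    ⟨Function.argmin fun l => (I l).card, fun l => Function.argmin_le (fun l => (I l).card) l⟩
  refine ⟨t, ?_⟩
  have hmemI : ∀ l p, l.foldl s p ∈ I l := fun l p =>
    Finset.mem_image_of_mem _ (Finset.mem_univ p)
  have hbij : ∀ l : List {u : List A // u.length ≤ n},
      (I t).image (fun y => t.foldl s (l.foldl s y)) = I t := by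
    intro l
    have h1 : (I t).image (fun y => t.foldl s (l.foldl s y)) = I (t ++ l ++ t) := by
      simp only [I]
      rw [Finset.image_image]
      congr 1
      ext p
      simp
    refine Finset.eq_of_subset_of_card_le ?_ (h1 ▸ ht _)
    intro z hz
    obtain ⟨y, -, rfl⟩ := Finset.mem_image.1 hz
    exact hmemI t _
  let p₀ : Set.range (act δ w) := ⟨act δ w r₀, r₀, rfl⟩
  let i₀ := t.foldl s p₀
  let k := (I t).card
  let g : Fin n → ℝ := fun q => if t.foldl s ⟨act δ w q, q, rfl⟩ = i₀ then 1 else 0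
  have hk : 0 < k := Finset.card_pos.2 ⟨i₀, hmemI t p₀⟩
  let φ : (Fin n → ℝ) →ₗ[ℝ] ℝ := ∑ y ∈ I t, LinearMap.proj (y : Fin n)
  have hφ : ∀ f, φ f = ∑ y ∈ I t, f y := fun f => by simp [φ, LinearMap.sum_apply]
  have hshort : ∀ u : List A, u.length ≤ n →
      φ ((fun q => g q - 1 / k) ∘ act δ u) = 0 := by
    intro u hu
    have hinj : Set.InjOn (fun y => t.foldl s (s y ⟨u, hu⟩)) (I t) := by
      have := hbij [⟨u, hu⟩]
      simp only [List.foldl_cons, List.foldl_nil] at this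
      exact Finset.card_image_iff.1 (by rw [this])
    have hi : i₀ ∈ (I t).image (fun y => t.foldl s (s y ⟨u, hu⟩)) := by
      have := hbij [⟨u, hu⟩]
      simp only [List.foldl_cons, List.foldl_nil] at this
      rw [this]
      exact hmemI t p₀
    obtain ⟨y₀, hy₀, hy₀'⟩ := Finset.mem_image.1 hi
    have hg : ∀ y ∈ I t, g (act δ u y) = if y = y₀ then 1 else 0 := by
      intro y hy
      have : (⟨act δ w (act δ u y), act δ u y, rfl⟩ : Set.range (act δ w)) =
          s y ⟨u, hu⟩ := Subtype.ext (hs y ⟨u, hu⟩).symm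
      simp only [g, this]
      refine if_congr ⟨fun h => ?_, ?_⟩ rfl rfl
      · exact hinj hy hy₀ (h.trans hy₀'.symm)
      · rintro rfl
        exact hy₀'
    rw [hφ]
    simp only [Function.comp_apply, Finset.sum_sub_distrib]
    rw [Finset.sum_congr rfl hg, Finset.sum_ite_eq' (I t) y₀, if_pos hy₀]
    have : (k : ℝ) ≠ 0 := by positivity
    simp only [Finset.sum_const, nsmul_eq_mul]
    change 1 - (k : ℝ) * (1 / k) = 0
    field_simp
    ring
  have hzero := linear_eq_zero_of_short_words δ _ φ hshort x
  rw [hφ] at hzero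
  have hgr : g r₀ = 1 := if_pos rfl
  simp only [Function.comp_apply, hx, hgr, Finset.sum_const, nsmul_eq_mul] at hzero
  have hk1 : k = 1 := by
    have hk' : (k : ℝ) ≠ 0 := by positivity
    have : (k : ℝ) * (1 - 1 / k) = 0 := hzero
    field_simp at this
    exact_mod_cast (by linarith : (k : ℝ) = 1)
  intro p q
  exact Finset.card_le_one.1 hk1.le _ (hmemI t p) _ (hmemI t q)

theorem exists_short_sync_word {n : ℕ} {A : Type*} (δ : Fin n → A → Fin n)
    (hδ : IsSynchronizing δ) (w : List A) (r : ℕ)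
    (hr : (Finset.univ.image (act δ w)).card ≤ r) :
    ∃ v : List A, v.length ≤ w.length + r ^ 3 * (n + w.length) ∧ IsSyncWord δ v := by
  let s : Set.range (act δ w) → {u : List A // u.length ≤ n} → Set.range (act δ w) :=
    fun q u => ⟨act δ w (act δ u q), act δ u q, rfl⟩
  obtain ⟨l, hl, hsync⟩ :=
    exists_sync_word_of_cube s (exists_sync_word_on_range δ hδ w s fun _ _ => rfl)
  have hcard : Fintype.card (Set.range (act δ w)) ≤ r := by
    rwa [← Set.toFinset_card, Set.toFinset_range]
  have hexp : ∀ l : List {u : List A // u.length ≤ n}, ∃ v : List A,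
      v.length ≤ l.length * (n + w.length) ∧ ∀ q : Set.range (act δ w),
      act δ v q = (l.foldl s q).1 := by
    intro l
    induction l with
    | nil => exact ⟨[], by simp, fun _ => rfl⟩
    | cons u l ih =>
      obtain ⟨v, hv, hact⟩ := ih
      refine ⟨u.1 ++ w ++ v, ?_, fun q => ?_⟩
      · have := u.2
        simp only [List.length_append, List.length_cons, add_mul]
        omega
      · rw [act_append, act_append, List.foldl_cons, ← hact]
  obtain ⟨v, hv, hact⟩ := hexp l
  obtain ⟨x, r₀, -⟩ := hδ
  refine ⟨w ++ v, ?_, act δ (w ++ v) r₀, fun q => ?_⟩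
  · rw [List.length_append]
    gcongr
    exact hv.trans (by gcongr; exact hl.trans (by gcongr))
  · rw [act_append, act_append]
    exact (hact ⟨_, q, rfl⟩).trans ((congrArg Subtype.val (hsync _ _)).trans (hact ⟨_, r₀, rfl⟩).symm)

theorem pow_mul_add_le_pow {u A : ℝ} (hu : 0 ≤ u) (hA : 0 ≤ A) (t : ℕ) :
    u ^ t * (u + (t + 1) * (A - u)) ≤ A ^ (t + 1) := by
  induction t with
  | zero => simp
  | succ t ih =>
    have h1 := mul_le_mul_of_nonneg_left ih hA
    have h2 : 0 ≤ u ^ t * ((t + 1) * (A - u) ^ 2) := by positivity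
    push_cast
    calc u ^ (t + 1) * (u + (t + 1 + 1) * (A - u))
        = A * (u ^ t * (u + (t + 1) * (A - u))) - u ^ t * ((t + 1) * (A - u) ^ 2) := by ring
      _ ≤ A * A ^ (t + 1) := by linarith
      _ = A ^ (t + 1 + 1) := by ring

/-- Maclaurin's inequality for elementary symmetric sums. -/
theorem sum_powersetCard_prod_le {ι : Type*} (w : ι → ℝ) (hw : ∀ i, 0 ≤ w i) (s : Finset ι)
    (t : ℕ) :
    ∑ S ∈ s.powersetCard t, ∏ i ∈ S, w i ≤ s.card.choose t * ((∑ i ∈ s, w i) / s.card) ^ t := by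
  induction s using Finset.induction_on generalizing t with
  | empty =>
    cases t with
    | zero => simp
    | succ t => simp [Finset.powersetCard_eq_empty.2 (Finset.card_empty.trans_lt t.succ_pos)]
  | insert a s ha ih =>
    cases t with
    | zero => simp
    | succ t =>
      have hsplit : ∑ S ∈ (insert a s).powersetCard (t + 1), ∏ i ∈ S, w i =
          ∑ S ∈ s.powersetCard (t + 1), ∏ i ∈ S, w i +
            w a * ∑ S ∈ s.powersetCard t, ∏ i ∈ S, w i := by
        have hnot : ∀ S ∈ s.powersetCard t, a ∉ S := fun S hS haS =>
          ha ((Finset.mem_powersetCard.1 hS).1 haS)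
        rw [Finset.powersetCard_succ_insert ha, Finset.sum_union, Finset.sum_image, Finset.mul_sum]
        · congr 1
          exact Finset.sum_congr rfl fun S hS => Finset.prod_insert (hnot S hS)
        · intro S hS T hT h
          rw [← Finset.erase_insert (hnot S hS), ← Finset.erase_insert (hnot T hT)]
          exact congrArg (Finset.erase · a) h
        · refine Finset.disjoint_left.2 fun S hS hS' => ?_
          obtain ⟨T, -, rfl⟩ := Finset.mem_image.1 hS'
          exact ha ((Finset.mem_powersetCard.1 hS).1 (Finset.mem_insert_self a T))
      rw [hsplit, Finset.card_insert_of_notMem ha, Finset.sum_insert ha]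
      obtain ⟨m, hm⟩ : ∃ m, s.card = m := ⟨_, rfl⟩
      have h1 := ih (t + 1)
      have h0 := mul_le_mul_of_nonneg_left (ih t) (hw a)
      rw [hm] at h0 h1 ⊢
      set x := w a
      set u : ℝ := (∑ i ∈ s, w i) / m with hu
      have hx : 0 ≤ x := hw a
      have hu0 : 0 ≤ u := div_nonneg (Finset.sum_nonneg fun i _ => hw i) (by positivity)
      have hsum : ∑ i ∈ s, w i = m * u := by
        rcases Nat.eq_zero_or_pos m with h | h
        · have : s = ∅ := Finset.card_eq_zero.1 (hm.trans h)
          simp [this, h]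
        · rw [hu]
          field_simp
      rw [hsum]
      refine (add_le_add h1 h0).trans ?_
      set A : ℝ := (x + m * u) / ((m + 1 : ℕ) : ℝ) with hA
      have hA0 : 0 ≤ A := by positivity
      have hAe : x + m * u = (m + 1) * A := by
        rw [hA]
        push_cast
        field_simp
      have key := pow_mul_add_le_pow hu0 hA0 t
      have c1 : ((m.choose t : ℕ) : ℝ) * (m + 1) = (m + 1).choose (t + 1) * (t + 1) := by
        have := Nat.add_one_mul_choose_eq m t
        rw [mul_comm] at this
        exact_mod_cast this
      have c2 : (((m + 1).choose (t + 1) : ℕ) : ℝ) = m.choose t + m.choose (t + 1) := by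
        exact_mod_cast Nat.choose_succ_succ m t
      have hx' : x = (m + 1) * A - m * u := by linarith
      have hid : (m.choose (t + 1) : ℝ) * u ^ (t + 1) + x * (m.choose t * u ^ t) =
          (m + 1).choose (t + 1) * (u ^ t * (u + (t + 1) * (A - u))) := by
        have c3 : (m.choose (t + 1) : ℝ) = (m + 1).choose (t + 1) - m.choose t := by linarith
        rw [c3, hx']
        linear_combination (u ^ t * (A - u)) * c1
      rw [hid]
      gcongr

theorem descFactorial_le_exp (m t : ℕ) :
    (m.descFactorial t : ℝ) ≤ m ^ t * Real.exp (-(t * (t - 1)) / (2 * m)) := by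
  induction t with
  | zero => simp
  | succ t ih =>
    rw [Nat.descFactorial_succ, Nat.cast_mul]
    rcases Nat.eq_zero_or_pos m with rfl | hm
    · simp
    have h1 : ((m - t : ℕ) : ℝ) ≤ m * Real.exp (-t / m) := by
      rcases le_total t m with h | h
      · rw [Nat.cast_sub h]
        calc (m : ℝ) - t = m * (-t / m + 1) := by field_simp; ring
          _ ≤ _ := by gcongr; exact Real.add_one_le_exp _
      · rw [Nat.sub_eq_zero_of_le h]
        simp only [Nat.cast_zero]
        positivity
    calc ((m - t : ℕ) : ℝ) * m.descFactorial t
        ≤ (m * Real.exp (-t / m)) * (m ^ t * Real.exp (-(t * (t - 1)) / (2 * m))) := by gcongr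
      _ = m ^ (t + 1) * (Real.exp (-t / m) * Real.exp (-(t * (t - 1)) / (2 * m))) := by ring
      _ = _ := by
        rw [← Real.exp_add]
        congr 2
        push_cast
        field_simp
        ring

/-- The number of `t`-tuples with pairwise distinct images under a map of rank at most `m`. -/
theorem card_injective_comp_le {n : ℕ} (g : Fin n → Fin n) (m : ℕ)
    (hm : (Finset.univ.image g).card ≤ m) (t : ℕ) :
    ((Finset.univ.filter fun y : Fin t → Fin n => Function.Injective (g ∘ y)).card : ℝ) ≤
      n ^ t * Real.exp (-(t * (t - 1)) / (2 * m)) := by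
  set W := Finset.univ.image g with hW
  let w : Fin n → ℝ := fun c => ((Finset.univ.filter fun x => g x = c).card : ℝ)
  have hsum : ∑ c ∈ W, w c = n := by
    have := Finset.card_eq_sum_card_image g Finset.univ
    simp only [Finset.card_univ, Fintype.card_fin] at this
    simp only [w]
    exact_mod_cast this.symm
  have hcount : ((Finset.univ.filter fun y : Fin t → Fin n => Function.Injective (g ∘ y)).card : ℝ)
      ≤ ∑ S ∈ W.powersetCard t, t.factorial * ∏ c ∈ S, w c := by
    have hsub : (Finset.univ.filter fun y : Fin t → Fin n => Function.Injective (g ∘ y)) ⊆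
        (W.powersetCard t).biUnion fun S => Finset.univ.filter fun y : Fin t → Fin n =>
          Function.Injective (g ∘ y) ∧ Finset.univ.image (g ∘ y) = S := by
      intro y hy
      have hy' : Function.Injective (g ∘ y) := (Finset.mem_filter.1 hy).2
      refine Finset.mem_biUnion.2 ⟨Finset.univ.image (g ∘ y), Finset.mem_powersetCard.2 ⟨?_, ?_⟩, ?_⟩
      · intro z hz
        obtain ⟨i, -, rfl⟩ := Finset.mem_image.1 hz
        exact Finset.mem_image_of_mem g (Finset.mem_univ _)
      · rw [Finset.card_image_of_injective _ hy']
        simp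
      · simpa using hy'
    refine (Nat.cast_le.2 ((Finset.card_le_card hsub).trans Finset.card_biUnion_le)).trans ?_
    push_cast
    refine Finset.sum_le_sum fun S hS => ?_
    have hScard := (Finset.mem_powersetCard.1 hS).2
    have hsub' : (Finset.univ.filter fun y : Fin t → Fin n =>
          Function.Injective (g ∘ y) ∧ Finset.univ.image (g ∘ y) = S) ⊆
        (Finset.univ : Finset (Fin t ≃ S)).biUnion fun e =>
          Fintype.piFinset fun i => Finset.univ.filter fun x => g x = e i := by
      intro y hy
      obtain ⟨hinj, himg⟩ := (Finset.mem_filter.1 hy).2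
      have hmem : ∀ i, g (y i) ∈ S := fun i =>
        himg ▸ Finset.mem_image_of_mem (g ∘ y) (Finset.mem_univ i)
      have hb : Function.Bijective (fun i => (⟨g (y i), hmem i⟩ : S)) := by
        rw [Fintype.bijective_iff_injective_and_card]
        refine ⟨fun i j h => hinj (congrArg Subtype.val h), ?_⟩
        simp [hScard]
      refine Finset.mem_biUnion.2 ⟨Equiv.ofBijective _ hb, Finset.mem_univ _, ?_⟩
      simp [Fintype.mem_piFinset]
    refine (Nat.cast_le.2 ((Finset.card_le_card hsub').trans Finset.card_biUnion_le)).trans ?_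
    push_cast
    have hterm : ∀ e : Fin t ≃ S, ((Fintype.piFinset fun i : Fin t =>
        Finset.univ.filter fun x => g x = e i).card : ℝ) = ∏ c ∈ S, w c := by
      intro e
      rw [Fintype.card_piFinset]
      push_cast
      rw [Equiv.prod_comp e fun c : S => w c]
      exact Finset.prod_coe_sort S w
    rw [Finset.sum_congr rfl fun e _ => hterm e, Finset.sum_const, Finset.card_univ,
      Fintype.card_equiv ((Fintype.equivFinOfCardEq (by simp [hScard])).symm), Fintype.card_fin,
      nsmul_eq_mul]
  refine hcount.trans ?_
  rw [← Finset.mul_sum]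
  have hE := sum_powersetCard_prod_le w (fun c => Nat.cast_nonneg _) W t
  rw [hsum] at hE
  have hd := descFactorial_le_exp W.card t
  rw [Nat.descFactorial_eq_factorial_mul_choose, Nat.cast_mul] at hd
  rcases Nat.eq_zero_or_pos W.card with h0 | hpos
  · have hn : n = 0 := by
      rw [hW, Finset.card_eq_zero, Finset.image_eq_empty] at h0
      simpa using congrArg Finset.card h0
    rw [h0] at hE
    refine (mul_le_mul_of_nonneg_left hE (by positivity)).trans ?_
    cases t with
    | zero => simp
    | succ t => simp [hn]
  have hWR : (0 : ℝ) < W.card := by exact_mod_cast hpos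
  calc (t.factorial : ℝ) * ∑ S ∈ W.powersetCard t, ∏ c ∈ S, w c
      ≤ t.factorial * (W.card.choose t * (n / W.card) ^ t) := by gcongr
    _ = (t.factorial * W.card.choose t) * (n / W.card) ^ t := by ring
    _ ≤ (W.card ^ t * Real.exp (-(t * (t - 1)) / (2 * W.card))) * (n / W.card) ^ t := by gcongr
    _ = n ^ t * Real.exp (-(t * (t - 1)) / (2 * W.card)) := by
      rw [div_pow]
      field_simp
    _ ≤ _ := by
      have ht : (0 : ℝ) ≤ t * (t - 1) := by
        cases t with
        | zero => simp
        | succ t =>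
          push_cast
          rw [add_sub_cancel_right]
          positivity
      refine mul_le_mul_of_nonneg_left (Real.exp_le_exp.2 ?_) (by positivity)
      rw [neg_div, neg_div, neg_le_neg_iff]
      exact div_le_div_of_nonneg_left ht (by positivity) (by gcongr)

/-- Union bound for maps `b` that follow an adaptive sequence of `t` queries whose answers have
pairwise distinct images under `g`. -/
theorem card_le_of_queries {n : ℕ} (g : Fin n → Fin n) (m : ℕ)
    (hm : (Finset.univ.image g).card ≤ m) (t : ℕ) (P : (Fin t → Fin n) → Fin t → Fin n)
    (B : Finset (Fin n → Fin n))
    (hB : ∀ b ∈ B, ∃ y, Function.Injective (P y) ∧ Function.Injective (g ∘ y) ∧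
      ∀ i, b (P y i) = y i) :
    (B.card : ℝ) ≤ n ^ n * Real.exp (-(t * (t - 1)) / (2 * m)) := by
  set D := Finset.univ.filter fun y : Fin t → Fin n => Function.Injective (g ∘ y) with hD
  have hsub : B ⊆ (D.filter fun y => Function.Injective (P y)).biUnion fun y =>
      Finset.univ.filter fun b => ∀ i, b (P y i) = y i := by
    intro b hb
    obtain ⟨y, h1, h2, h3⟩ := hB b hb
    exact Finset.mem_biUnion.2 ⟨y, by simp [hD, h1, h2], by simpa using h3⟩
  have hcard : ∀ y ∈ D.filter fun y => Function.Injective (P y),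
      ((Finset.univ.filter fun b : Fin n → Fin n => ∀ i, b (P y i) = y i).card) ≤ n ^ (n - t) := by
    intro y hy
    have hinj : Function.Injective (P y) := (Finset.mem_filter.1 hy).2
    let F : Fin n → Finset (Fin n) := fun x =>
      if h : ∃ i, P y i = x then {y h.choose} else Finset.univ
    have hF : ∀ x, (F x).card = if x ∈ Finset.univ.image (P y) then 1 else n := by
      intro x
      by_cases h : ∃ i, P y i = x
      · rw [if_pos (by simpa using h)]
        simp [F, h]
      · rw [if_neg (by simpa using h)]
        simp [F, h]
    have hsub : (Finset.univ.filter fun b : Fin n → Fin n => ∀ i, b (P y i) = y i) ⊆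
        Fintype.piFinset F := by
      intro b hb
      have hb' := (Finset.mem_filter.1 hb).2
      refine Fintype.mem_piFinset.2 fun x => ?_
      by_cases h : ∃ i, P y i = x
      · simp only [F, dif_pos h, Finset.mem_singleton]
        rw [← hb' h.choose, h.choose_spec]
      · simp [F, h]
    refine (Finset.card_le_card hsub).trans ?_
    rw [Fintype.card_piFinset, Finset.prod_congr rfl fun x _ => hF x, Finset.prod_ite]
    have : (Finset.univ.filter fun x => x ∉ Finset.univ.image (P y)).card = n - t := by
      rw [← Finset.compl_filter, Finset.card_compl]
      simp only [Finset.filter_univ_mem]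
      rw [Finset.card_image_of_injective _ hinj]
      simp
    rw [Finset.prod_const, Finset.prod_const, this]
    simp
  have hle : B.card ≤ D.card * n ^ (n - t) := by
    refine (Finset.card_le_card hsub).trans (Finset.card_biUnion_le.trans ?_)
    refine (Finset.sum_le_sum hcard).trans ?_
    rw [Finset.sum_const, smul_eq_mul]
    gcongr
    exact Finset.filter_subset _ _
  rcases Finset.eq_empty_or_nonempty B with h | ⟨b, hb⟩
  · rw [h]
    simp only [Finset.card_empty, Nat.cast_zero]
    positivity
  have htn : t ≤ n := by
    obtain ⟨y, h1, -⟩ := hB b hb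
    simpa using Fintype.card_le_of_injective _ h1
  have hDc := card_injective_comp_le g m hm t
  calc (B.card : ℝ) ≤ D.card * n ^ (n - t) := by exact_mod_cast hle
    _ ≤ (n ^ t * Real.exp (-(t * (t - 1)) / (2 * m))) * n ^ (n - t) := by gcongr
    _ = (n ^ t * n ^ (n - t)) * Real.exp (-(t * (t - 1)) / (2 * m)) := by ring
    _ = _ := by rw [← pow_add, Nat.add_sub_cancel' htn]

theorem card_injective_orbit_le {n : ℕ} (g : Fin n → Fin n) (m : ℕ)
    (hm : (Finset.univ.image g).card ≤ m) (t : ℕ) (x : Fin n) :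
    ((Finset.univ.filter fun b : Fin n → Fin n =>
      Set.InjOn (fun i : ℕ => (g ∘ b)^[i] x) (Set.Iic t)).card : ℝ) ≤
      n ^ n * Real.exp (-(t * (t - 1)) / (2 * m)) := by
  refine card_le_of_queries g m hm t
    (fun y i => if h : (i : ℕ) = 0 then x else g (y ⟨i - 1, by omega⟩)) _ fun b hb => ?_
  have hb' := (Finset.mem_filter.1 hb).2
  have hP : ∀ i : Fin t, (if h : (i : ℕ) = 0 then x
      else g (b ((g ∘ b)^[(i : ℕ) - 1] x))) = (g ∘ b)^[i] x := by
    rintro ⟨i, hi⟩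
    cases i with
    | zero => simp
    | succ i => simp [Function.iterate_succ_apply', -Function.iterate_succ]
  refine ⟨fun i => b ((g ∘ b)^[i] x), fun i j hij => ?_, fun i j hij => ?_, fun i => ?_⟩
  · simp only [hP] at hij
    exact Fin.ext (hb' (Set.mem_Iic.2 i.2.le) (Set.mem_Iic.2 j.2.le) hij)
  · have hij' : (g ∘ b)^[(i : ℕ) + 1] x = (g ∘ b)^[(j : ℕ) + 1] x := by
      rw [Function.iterate_succ_apply', Function.iterate_succ_apply']
      exact hij
    have := hb' (Set.mem_Iic.2 i.2) (Set.mem_Iic.2 j.2) hij'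
    exact Fin.ext (Nat.succ_injective this)
  · simp only [hP]

theorem card_periodicPts_eq_le {n : ℕ} (g : Fin n → Fin n) (m : ℕ)
    (hm : (Finset.univ.image g).card ≤ m) (t : ℕ) :
    ((Finset.univ.filter fun b : Fin n → Fin n =>
      (Function.periodicPts (g ∘ b)).toFinset.card = t).card : ℝ) ≤
      n ^ n * Real.exp (-(t * (t - 1)) / (2 * m)) := by
  let Q : Finset (Fin n) → (Fin t → Fin n) → Fin t → Fin n := fun S y =>
    if h : S.card = t then fun i => (S.equivFinOfCardEq h).symm i else y
  refine card_le_of_queries g m hm t (fun y => Q (Finset.univ.image (g ∘ y)) y) _ fun b hb => ?_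
  have hcard := (Finset.mem_filter.1 hb).2
  set S := (Function.periodicPts (g ∘ b)).toFinset with hS
  have hbij : Set.BijOn (g ∘ b) S S := by
    rw [hS, Set.coe_toFinset]
    exact Function.bijOn_periodicPts _
  let e := (S.equivFinOfCardEq hcard).symm
  have himg : Finset.univ.image (g ∘ fun i => b (e i)) = S := by
    ext z
    constructor
    · intro hz
      obtain ⟨i, -, rfl⟩ := Finset.mem_image.1 hz
      exact hbij.mapsTo (e i).2
    · intro hz
      obtain ⟨c, hc, rfl⟩ := hbij.surjOn hz
      exact Finset.mem_image.2 ⟨e.symm ⟨c, hc⟩, Finset.mem_univ _, by simp⟩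
  have hQ : ∀ y, Q S y = fun i => (e i : Fin n) := fun y => dif_pos hcard
  refine ⟨fun i => b (e i), ?_, fun i j hij => ?_, fun i => ?_⟩
  · simp only [himg, hQ]
    exact Subtype.val_injective.comp e.injective
  · exact e.injective (Subtype.ext (hbij.injOn (e i).2 (e j).2 hij))
  · simp only [himg, hQ]

/-- For most maps `b`, the `t`-th iterate of `g ∘ b` has rank less than `t`. -/
theorem card_le_rank_iterate_le {n : ℕ} (g : Fin n → Fin n) (m : ℕ)
    (hm : (Finset.univ.image g).card ≤ m) (t : ℕ) (ht : 1 ≤ t) :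
    ((Finset.univ.filter fun b : Fin n → Fin n =>
      t ≤ (Finset.univ.image (g ∘ b)^[t]).card).card : ℝ) ≤
      2 * n * Real.exp (-(t * (t - 1)) / (2 * m)) * n ^ n := by
  have hsub : (Finset.univ.filter fun b : Fin n → Fin n =>
      t ≤ (Finset.univ.image (g ∘ b)^[t]).card) ⊆
      (Finset.univ.biUnion fun x => Finset.univ.filter fun b : Fin n → Fin n =>
        Set.InjOn (fun i : ℕ => (g ∘ b)^[i] x) (Set.Iic t)) ∪
      ((Finset.Icc t n).biUnion fun j => Finset.univ.filter fun b : Fin n → Fin n =>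
        (Function.periodicPts (g ∘ b)).toFinset.card = j) := by
    intro b hb
    have hb' := (Finset.mem_filter.1 hb).2
    rw [Finset.mem_union]
    by_cases h : ∃ x, Set.InjOn (fun i : ℕ => (g ∘ b)^[i] x) (Set.Iic t)
    · left
      simpa using h
    · right
      push Not at h
      have hsubset : Finset.univ.image (g ∘ b)^[t] ⊆ (Function.periodicPts (g ∘ b)).toFinset := by
        intro z hz
        obtain ⟨x, -, rfl⟩ := Finset.mem_image.1 hz
        rw [Set.mem_toFinset]
        have key : ∀ i j, i < j → j ≤ t → (g ∘ b)^[i] x = (g ∘ b)^[j] x →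
            (g ∘ b)^[t] x ∈ Function.periodicPts (g ∘ b) := by
          intro i j hij hj heq
          have hp : Function.IsPeriodicPt (g ∘ b) (j - i) ((g ∘ b)^[i] x) := by
            change (g ∘ b)^[j - i] ((g ∘ b)^[i] x) = _
            rw [← Function.iterate_add_apply, Nat.sub_add_cancel hij.le, heq]
          have := hp.apply_iterate (t - i)
          rw [← Function.iterate_add_apply, Nat.sub_add_cancel (hij.le.trans hj)] at this
          exact Function.mk_mem_periodicPts (by omega) this
        have hx := h x
        simp only [Set.InjOn, not_forall] at hx
        obtain ⟨i, hi, j, hj, heq, hne⟩ := hx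
        rcases lt_or_gt_of_ne hne with hlt | hlt
        · exact key i j hlt hj heq
        · exact key j i hlt hi heq.symm
      refine Finset.mem_biUnion.2 ⟨(Function.periodicPts (g ∘ b)).toFinset.card, ?_, by simp⟩
      refine Finset.mem_Icc.2 ⟨hb'.trans (Finset.card_le_card hsubset), ?_⟩
      simpa using Finset.card_le_univ (Function.periodicPts (g ∘ b)).toFinset
  refine (Nat.cast_le.2 ((Finset.card_le_card hsub).trans (Finset.card_union_le _ _))).trans ?_
  have h1 : ((Finset.univ.biUnion fun x => Finset.univ.filter fun b : Fin n → Fin n =>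
        Set.InjOn (fun i : ℕ => (g ∘ b)^[i] x) (Set.Iic t)).card : ℝ) ≤
      n * (n ^ n * Real.exp (-(t * (t - 1)) / (2 * m))) := by
    refine (Nat.cast_le.2 Finset.card_biUnion_le).trans ?_
    push_cast
    refine (Finset.sum_le_sum fun x _ => card_injective_orbit_le g m hm t x).trans ?_
    simp
  have h2 : (((Finset.Icc t n).biUnion fun j => Finset.univ.filter fun b : Fin n → Fin n =>
        (Function.periodicPts (g ∘ b)).toFinset.card = j).card : ℝ) ≤
      n * (n ^ n * Real.exp (-(t * (t - 1)) / (2 * m))) := by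
    refine (Nat.cast_le.2 Finset.card_biUnion_le).trans ?_
    push_cast
    have : ∀ j ∈ Finset.Icc t n, ((Finset.univ.filter fun b : Fin n → Fin n =>
        (Function.periodicPts (g ∘ b)).toFinset.card = j).card : ℝ) ≤
        n ^ n * Real.exp (-(t * (t - 1)) / (2 * m)) := by
      intro j hj
      refine (card_periodicPts_eq_le g m hm j).trans ?_
      have htj : (t : ℝ) ≤ j := by exact_mod_cast (Finset.mem_Icc.1 hj).1
      have ht1 : (1 : ℝ) ≤ t := by exact_mod_cast ht
      refine mul_le_mul_of_nonneg_left (Real.exp_le_exp.2 ?_) (by positivity)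
      rw [neg_div, neg_div, neg_le_neg_iff]
      refine div_le_div_of_nonneg_right ?_ (by positivity)
      nlinarith
    refine (Finset.sum_le_sum this).trans ?_
    rw [Finset.sum_const, nsmul_eq_mul, Nat.card_Icc]
    gcongr
    omega
  push_cast
  linarith

/-- At least a fraction `1 / n` of all maps `f : Fin n → Fin n` have a constant iterate
(Joyal's correspondence between maps and doubly rooted trees). -/
theorem pow_le_mul_card_iterate_const {n : ℕ} (hn : 0 < n) :
    n ^ n ≤ n * (Finset.univ.filter fun f : Fin n → Fin n =>
      ∃ N r, ∀ x, f^[N] x = r).card := by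
  let Z := Finset.univ.filter fun f : Fin n → Fin n => ∃ N r, ∀ x, f^[N] x = r
  let orb : (Fin n → Fin n) → Fin n → Finset (Fin n) := fun f v =>
    Finset.univ.filter fun y => ∃ i : ℕ, f^[i] v = y
  let Ψ : (Fin n → Fin n) × Fin n → Fin n → Fin n := fun p x =>
    if h : x ∈ orb p.1 p.2 then p.1^[(orb p.1 p.2).equivFin ⟨x, h⟩] p.2 else p.1 x
  have hsurj : (Finset.univ : Finset (Fin n → Fin n)) ⊆ (Z ×ˢ Finset.univ).image Ψ := by
    intro f _
    set S := (Function.periodicPts f).toFinset with hS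
    have hbij : Set.BijOn f S S := by
      rw [hS, Set.coe_toFinset]
      exact Function.bijOn_periodicPts _
    have hreach : ∀ x, ∃ j, f^[j] x ∈ S := by
      intro x
      obtain ⟨i, j, hij, heq⟩ := Finite.exists_ne_map_eq_of_infinite fun i : ℕ => f^[i] x
      wlog hlt : i < j generalizing i j
      · exact this j i hij.symm heq.symm (by omega)
      refine ⟨i, ?_⟩
      rw [hS, Set.mem_toFinset]
      refine Function.mk_mem_periodicPts (n := j - i) (by omega) ?_
      change f^[j - i] (f^[i] x) = _
      rw [← Function.iterate_add_apply, Nat.sub_add_cancel hlt.le]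
      exact heq.symm
    have hk : 0 < S.card := by
      obtain ⟨j, hj⟩ := hreach ⟨0, hn⟩
      exact Finset.card_pos.2 ⟨_, hj⟩
    let E : Fin S.card ≃ S := S.equivFin.symm.trans (Set.BijOn.equiv f hbij)
    have hE : ∀ x : S, (E (S.equivFin x) : Fin n) = f x := by
      intro x
      simp only [E, Equiv.trans_apply, Equiv.symm_apply_apply]
      rfl
    let nxt : Fin S.card → Fin S.card := fun i => ⟨min (i + 1) (S.card - 1), by omega⟩
    let f' : Fin n → Fin n := fun x => if h : x ∈ S then E (nxt (E.symm ⟨x, h⟩)) else f x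
    have hf'E : ∀ i, f' (E i) = E (nxt i) := by
      intro i
      simp [f']
    let v : Fin n := E ⟨0, hk⟩
    have hiter : ∀ a b : ℕ, (ha : a < S.card) →
        f'^[b] (E ⟨a, ha⟩) = E ⟨min (a + b) (S.card - 1), by omega⟩ := by
      intro a b ha
      induction b with
      | zero =>
        exact congrArg (fun i => (E i : Fin n))
          (Fin.ext (by change a = min (a + 0) (S.card - 1); omega))
      | succ b ih =>
        rw [Function.iterate_succ_apply', ih, hf'E]
        congr 2
        exact Fin.ext (by simp only [nxt]; omega)
    have horb : orb f' v = S := by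
      ext y
      simp only [orb, Finset.mem_filter, Finset.mem_univ, true_and]
      constructor
      · rintro ⟨i, rfl⟩
        rw [hiter]
        exact (E _).2
      · intro hy
        obtain ⟨⟨i, hi⟩, hi'⟩ := E.surjective ⟨y, hy⟩
        refine ⟨i, ?_⟩
        rw [hiter]
        have : min (0 + i) (S.card - 1) = i := by omega
        simp only [this]
        exact congrArg Subtype.val hi'
    refine Finset.mem_image.2 ⟨(f', v), Finset.mem_product.2 ⟨?_, Finset.mem_univ _⟩, ?_⟩
    · let last : Fin n := E ⟨S.card - 1, by omega⟩
      have hlast : ∀ b, f'^[b] last = last := by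
        intro b
        rw [hiter]
        congr 3
        omega
      have hto : ∀ j x, f^[j] x ∈ S → ∃ N, f'^[N] x = last := by
        intro j
        induction j with
        | zero =>
          intro x hx
          obtain ⟨⟨i, hi⟩, hi'⟩ := E.surjective ⟨x, hx⟩
          have hi'' : (E ⟨i, hi⟩ : Fin n) = x := congrArg Subtype.val hi'
          refine ⟨S.card, ?_⟩
          rw [← hi'', hiter]
          congr 3
          omega
        | succ j ih =>
          intro x hx
          by_cases hxS : x ∈ S
          · obtain ⟨⟨i, hi⟩, hi'⟩ := E.surjective ⟨x, hxS⟩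
            have hi'' : (E ⟨i, hi⟩ : Fin n) = x := congrArg Subtype.val hi'
            refine ⟨S.card, ?_⟩
            rw [← hi'', hiter]
            congr 3
            omega
          · obtain ⟨N, hN⟩ := ih (f x) hx
            refine ⟨N + 1, ?_⟩
            rw [Function.iterate_succ_apply]
            have : f' x = f x := dif_neg hxS
            rw [this, hN]
      have hall : ∀ x, ∃ N, f'^[N] x = last := fun x => by
        obtain ⟨j, hj⟩ := hreach x
        exact hto j x hj
      choose N hN using hall
      refine Finset.mem_filter.2 ⟨Finset.mem_univ _, Finset.univ.sup N, last, fun x => ?_⟩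
      have hle : N x ≤ Finset.univ.sup N := Finset.le_sup (Finset.mem_univ x)
      rw [← Nat.sub_add_cancel hle, Function.iterate_add_apply, hN, hlast]
    · ext1 x
      have hΨ : ∀ T : Finset (Fin n), T = S →
          (if h : x ∈ T then f'^[T.equivFin ⟨x, h⟩] v else f' x) = f x := by
        rintro T rfl
        by_cases hx : x ∈ S
        · rw [dif_pos hx, hiter, ← hE ⟨x, hx⟩]
          congr 2
          ext
          simp only
          omega
        · rw [dif_neg hx]
          exact dif_neg hx
      exact hΨ _ horb
  have := (Finset.card_le_card hsurj).trans Finset.card_image_le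
  rw [Finset.card_product, Finset.card_univ, Finset.card_univ, Fintype.card_fun,
    Fintype.card_fin] at this
  rwa [mul_comm]

/-- The automaton obtained from `δ` by letting the letter `c` act as `f`. -/
def replaceLetter {n : ℕ} {A : Type*} [DecidableEq A] (c : A) (δ : Fin n → A → Fin n)
    (f : Fin n → Fin n) : Fin n → A → Fin n :=
  fun q => Function.update (δ q) c (f q)

theorem replaceLetter_replaceLetter {n : ℕ} {A : Type*} [DecidableEq A] (c : A)
    (δ : Fin n → A → Fin n) (f : Fin n → Fin n) :
    replaceLetter c (replaceLetter c δ f) (fun q => δ q c) = δ := by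
  ext q d
  simp [replaceLetter]

theorem replaceLetter_injective {n : ℕ} {A : Type*} [DecidableEq A] (c : A) :
    Function.Injective fun p : (Fin n → A → Fin n) × (Fin n → Fin n) =>
      (replaceLetter c p.1 p.2, fun q => p.1 q c) := by
  rintro ⟨δ, f⟩ ⟨δ', f'⟩ h
  simp only [Prod.mk.injEq] at h
  obtain ⟨h1, h2⟩ := h
  have hδ : δ = δ' := by
    rw [← replaceLetter_replaceLetter c δ f, h1, h2, replaceLetter_replaceLetter]
  have hf : f = f' := by
    ext q
    simpa [replaceLetter] using congrArg Fin.val (congrFun (congrFun h1 q) c)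
  rw [hδ, hf]

theorem card_le_of_replaceLetter {n : ℕ} {A : Type*} [Fintype A] [DecidableEq A] (c : A)
    (p : (Fin n → A → Fin n) → Prop) [DecidablePred p] (ε : ℝ)
    (h : ∀ δ, ((Finset.univ.filter fun f => p (replaceLetter c δ f)).card : ℝ) ≤ ε * n ^ n) :
    ((Finset.univ.filter p).card : ℝ) ≤ ε * Fintype.card (Fin n → A → Fin n) := by
  have hcard : (Finset.univ.filter p).card * n ^ n ≤
      ∑ δ, (Finset.univ.filter fun f => p (replaceLetter c δ f)).card := by
    rw [← Finset.card_sigma]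
    have : n ^ n = (Finset.univ : Finset (Fin n → Fin n)).card := by simp
    rw [this, ← Finset.card_product]
    refine Finset.card_le_card_of_injOn
      (fun x => ⟨replaceLetter c x.1 x.2, fun q => x.1 q c⟩) ?_ ?_
    · rintro ⟨δ, f⟩ hx
      have hp : p δ := by simpa using hx
      simpa [replaceLetter_replaceLetter] using hp
    · rintro x - y - hxy
      simp only [Sigma.mk.injEq, heq_eq_eq] at hxy
      exact replaceLetter_injective c (Prod.ext hxy.1 hxy.2)
  have hpos : (0 : ℝ) < (n : ℝ) ^ n := by exact_mod_cast Nat.pow_self_pos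
  refine le_of_mul_le_mul_right ?_ hpos
  calc ((Finset.univ.filter p).card : ℝ) * n ^ n
      ≤ ∑ δ, ((Finset.univ.filter fun f => p (replaceLetter c δ f)).card : ℝ) := by
        exact_mod_cast hcard
    _ ≤ ∑ _δ : Fin n → A → Fin n, ε * n ^ n := Finset.sum_le_sum fun δ _ => h δ
    _ = _ := by
      rw [Finset.sum_const, nsmul_eq_mul, Finset.card_univ]
      ring

theorem act_replicate {n : ℕ} {A : Type*} (δ : Fin n → A → Fin n) (c : A) (M : ℕ) :
    act δ (List.replicate M c) = (fun q => δ q c)^[M] := by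
  induction M with
  | zero => rfl
  | succ M ih =>
    rw [List.replicate_succ, Function.iterate_succ, ← ih]
    rfl

theorem act_flatten_replicate {n : ℕ} {A : Type*} (δ : Fin n → A → Fin n) (w : List A) (R : ℕ) :
    act δ (List.replicate R w).flatten = (act δ w)^[R] := by
  induction R with
  | zero => rfl
  | succ R ih =>
    rw [List.replicate_succ, List.flatten_cons, Function.iterate_succ, ← ih]
    ext q
    rw [act_append]
    rfl

/-- At least a fraction `1 / n` of all automata are synchronizing. -/
theorem card_le_mul_card_isSynchronizing {n : ℕ} {A : Type*} [Fintype A] [DecidableEq A]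
    (hn : 0 < n) (c : A) :
    Fintype.card (Fin n → A → Fin n) ≤
      n * (Finset.univ.filter fun δ : Fin n → A → Fin n => IsSynchronizing δ).card := by
  set Z := Finset.univ.filter fun f : Fin n → Fin n => ∃ N r, ∀ x, f^[N] x = r with hZ
  set Y := Finset.univ.filter fun δ : Fin n → A → Fin n => IsSynchronizing δ with hY
  have hle : Fintype.card (Fin n → A → Fin n) * Z.card ≤ Y.card * n ^ n := by
    have : n ^ n = (Finset.univ : Finset (Fin n → Fin n)).card := by simp
    rw [this, ← Finset.card_univ, ← Finset.card_product, ← Finset.card_product]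
    refine Finset.card_le_card_of_injOn _ ?_ (replaceLetter_injective c).injOn
    rintro ⟨δ, f⟩ hx
    obtain ⟨N, r, hr⟩ : ∃ N r, ∀ x, f^[N] x = r := by simpa [hZ] using hx
    have hf : (fun q => replaceLetter c δ f q c) = f := by
      ext q
      simp [replaceLetter]
    have hsync : IsSynchronizing (replaceLetter c δ f) := by
      refine ⟨List.replicate N c, r, fun q => ?_⟩
      rw [act_replicate, hf, hr]
    simpa [hY] using hsync
  refine le_of_mul_le_mul_right ?_ (Nat.pow_self_pos (n := n))
  calc Fintype.card (Fin n → A → Fin n) * n ^ n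
      ≤ Fintype.card (Fin n → A → Fin n) * (n * Z.card) := by
        gcongr
        exact pow_le_mul_card_iterate_const hn
    _ = n * (Fintype.card (Fin n → A → Fin n) * Z.card) := by ring
    _ ≤ n * (Y.card * n ^ n) := by gcongr
    _ = _ := by ring

/-- Few synchronizing automata have no synchronizing word of length at most `L`. -/
theorem card_no_short_sync_word_le {n : ℕ} {A : Type*} [Fintype A] [DecidableEq A] (a b : A)
    (hab : a ≠ b) (M R L : ℕ) (hM : 1 ≤ M) (hR : 1 ≤ R)
    (hL : R * (M + 1) + R ^ 3 * (n + R * (M + 1)) ≤ L) :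
    ((Finset.univ.filter fun δ : Fin n → A → Fin n =>
      IsSynchronizing δ ∧ ¬ ∃ w : List A, w.length ≤ L ∧ IsSyncWord δ w).card : ℝ) ≤
      (2 * n * Real.exp (-(M * (M - 1)) / (2 * n)) + 2 * n * Real.exp (-(R * (R - 1)) / (2 * M))) *
        Fintype.card (Fin n → A → Fin n) := by
  let p₁ : (Fin n → A → Fin n) → Prop := fun δ =>
    M ≤ (Finset.univ.image (fun q => δ q a)^[M]).card
  let p₂ : (Fin n → A → Fin n) → Prop := fun δ =>
    (Finset.univ.image (fun q => δ q a)^[M]).card ≤ M ∧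
      R ≤ (Finset.univ.image ((fun q => δ q a)^[M] ∘ fun q => δ q b)^[R]).card
  have hsub : (Finset.univ.filter fun δ : Fin n → A → Fin n =>
      IsSynchronizing δ ∧ ¬ ∃ w : List A, w.length ≤ L ∧ IsSyncWord δ w) ⊆
      Finset.univ.filter p₁ ∪ Finset.univ.filter p₂ := by
    intro δ hδ
    obtain ⟨hsync, hno⟩ := (Finset.mem_filter.1 hδ).2
    by_contra hcon
    simp only [Finset.mem_union, Finset.mem_filter, Finset.mem_univ, true_and, not_or, p₁, p₂,
      not_and, not_le] at hcon
    obtain ⟨h1, h2⟩ := hcon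
    have h3 := h2 h1.le
    let w := (List.replicate R (b :: List.replicate M a)).flatten
    have hw : act δ w = ((fun q => δ q a)^[M] ∘ fun q => δ q b)^[R] := by
      rw [act_flatten_replicate]
      congr 1
      ext q
      rw [← act_replicate]
      rfl
    have hlen : w.length = R * (M + 1) := by simp [w]
    obtain ⟨v, hv, hvs⟩ := exists_short_sync_word δ hsync w R (by rw [hw]; exact h3.le)
    rw [hlen] at hv
    exact hno ⟨v, hv.trans hL, hvs⟩
  have hb₁ : ((Finset.univ.filter p₁).card : ℝ) ≤
      2 * n * Real.exp (-(M * (M - 1)) / (2 * n)) * Fintype.card (Fin n → A → Fin n) := by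
    refine card_le_of_replaceLetter a p₁ _ fun δ => ?_
    have := card_le_rank_iterate_le (id : Fin n → Fin n) n
      (by simp) M hM
    simpa [p₁, replaceLetter] using this
  have hb₂ : ((Finset.univ.filter p₂).card : ℝ) ≤
      2 * n * Real.exp (-(R * (R - 1)) / (2 * M)) * Fintype.card (Fin n → A → Fin n) := by
    refine card_le_of_replaceLetter b p₂ _ fun δ => ?_
    by_cases hm : (Finset.univ.image (fun q => δ q a)^[M]).card ≤ M
    · have := card_le_rank_iterate_le ((fun q => δ q a)^[M]) M hm R hR
      simpa [p₂, replaceLetter, hab, hm] using this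
    · have : (Finset.univ.filter fun f => p₂ (replaceLetter b δ f)) = ∅ := by
        simp [p₂, replaceLetter, hab, hm]
      rw [this]
      simp only [Finset.card_empty, Nat.cast_zero]
      positivity
  calc _ ≤ (((Finset.univ.filter p₁).card + (Finset.univ.filter p₂).card : ℕ) : ℝ) :=
        Nat.cast_le.2 ((Finset.card_le_card hsub).trans (Finset.card_union_le _ _))
    _ ≤ _ := by
      push_cast
      linarith

theorem exists_parameters (x : ℝ) (hx : 10 ≤ x) (n : ℕ) (hn : (n : ℝ) = x ^ 20) :
    ∃ M R : ℕ, 1 ≤ M ∧ 1 ≤ R ∧ R * (M + 1) + R ^ 3 * (n + R * (M + 1)) ≤ (n - 1) ^ 2 ∧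
      x / 8 ≤ M * (M - 1) / (2 * n) ∧ x / 8 ≤ R * (R - 1) / (2 * M) := by
  have hx0 : 0 < x := by linarith
  have hpow : ∀ k : ℕ, 1 ≤ x ^ k := fun k => one_le_pow₀ (by linarith)
  obtain ⟨M, hM1, hM2⟩ : ∃ M : ℕ, x ^ 11 ≤ M ∧ (M : ℝ) ≤ x ^ 11 + 1 :=
    ⟨⌈x ^ 11⌉₊, Nat.le_ceil _, (Nat.ceil_lt_add_one (by positivity)).le⟩
  obtain ⟨R, hR1, hR2⟩ : ∃ R : ℕ, x ^ 6 ≤ R ∧ (R : ℝ) ≤ x ^ 6 + 1 :=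
    ⟨⌈x ^ 6⌉₊, Nat.le_ceil _, (Nat.ceil_lt_add_one (by positivity)).le⟩
  have h11 : 10 ≤ x ^ 11 := hx.trans (le_self_pow₀ (by linarith) (by norm_num))
  have h6 : 10 ≤ x ^ 6 := hx.trans (le_self_pow₀ (by linarith) (by norm_num))
  have h20 : 10 ≤ x ^ 20 := hx.trans (le_self_pow₀ (by linarith) (by norm_num))
  refine ⟨M, R, ?_, ?_, ?_, ?_, ?_⟩
  · exact_mod_cast (by linarith : (1 : ℝ) ≤ M)
  · exact_mod_cast (by linarith : (1 : ℝ) ≤ R)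
  · have hn1 : 1 ≤ n := by exact_mod_cast (by linarith : (1 : ℝ) ≤ n)
    have hreal : (R : ℝ) * (M + 1) + R ^ 3 * (n + R * (M + 1)) ≤ (n - 1) ^ 2 := by
      have hRle : (R : ℝ) ≤ 2 * x ^ 6 := by linarith
      have hMle : (M : ℝ) + 1 ≤ 2 * x ^ 11 := by linarith
      have hℓ : (R : ℝ) * (M + 1) ≤ x ^ 20 := by
        calc (R : ℝ) * (M + 1) ≤ (2 * x ^ 6) * (2 * x ^ 11) := by gcongr
          _ = 4 * x ^ 17 := by ring
          _ ≤ x ^ 3 * x ^ 17 := by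
            gcongr
            exact le_trans (by linarith) (le_self_pow₀ (by linarith : 1 ≤ x) (by norm_num))
          _ = x ^ 20 := by ring
      have h38 : 100 * x ^ 38 ≤ x ^ 40 := by
        calc 100 * x ^ 38 ≤ x ^ 2 * x ^ 38 := by
              gcongr
              nlinarith
          _ = x ^ 40 := by ring
      have h2038 : x ^ 20 ≤ x ^ 38 := pow_le_pow_right₀ (by linarith) (by norm_num)
      calc (R : ℝ) * (M + 1) + R ^ 3 * (n + R * (M + 1))
          ≤ x ^ 20 + (2 * x ^ 6) ^ 3 * (x ^ 20 + x ^ 20) := by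
            rw [hn]
            gcongr
        _ = x ^ 20 + 16 * x ^ 38 := by ring
        _ ≤ x ^ 40 - 2 * x ^ 20 + 1 := by linarith
        _ = (n - 1) ^ 2 := by
          rw [hn]
          ring
    have : ((R * (M + 1) + R ^ 3 * (n + R * (M + 1)) : ℕ) : ℝ) ≤ (((n - 1) ^ 2 : ℕ) : ℝ) := by
      push_cast [Nat.cast_sub hn1]
      exact hreal
    exact_mod_cast this
  · rw [hn, le_div_iff₀ (by positivity)]
    have h22 : x ^ 21 ≤ x ^ 22 := pow_le_pow_right₀ (by linarith) (by norm_num)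
    calc x / 8 * (2 * x ^ 20) = x ^ 21 / 4 := by ring
      _ ≤ x ^ 22 / 2 := by linarith [pow_pos hx0 21]
      _ = x ^ 11 * (x ^ 11 / 2) := by ring
      _ ≤ M * (M - 1) := by
        gcongr
        linarith
  · have hM0 : (0 : ℝ) < M := by linarith
    rw [le_div_iff₀ (by positivity)]
    calc x / 8 * (2 * M) ≤ x / 8 * (2 * (2 * x ^ 11)) := by
          gcongr
          linarith
      _ = x ^ 6 * (x ^ 6 / 2) := by ring
      _ ≤ R * (R - 1) := by
        gcongr
        linarith

/-- For the uniform distribution on synchronizing deterministic complete `n`-state automata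
over an alphabet with at least two letters, the probability of admitting a synchronizing
word of length at most `(n-1)^2` tends to `1` as `n → ∞`: Černý's conjecture holds with
high probability. -/
theorem cerny_conjecture_whp (A : Type) [Fintype A] [DecidableEq A]
    (hA : 2 ≤ Fintype.card A) :
    Filter.Tendsto (fun n : ℕ =>
      (((Finset.univ : Finset (Fin n → A → Fin n)).filter
          (fun δ => IsSynchronizing δ ∧
            ∃ w : List A, w.length ≤ (n - 1) ^ 2 ∧ IsSyncWord δ w)).card : ℝ)
        / (((Finset.univ : Finset (Fin n → A → Fin n)).filter
            (fun δ => IsSynchronizing δ)).card : ℝ))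
      Filter.atTop (nhds 1) := by
  obtain ⟨a, b, hab⟩ := Fintype.one_lt_card_iff.1 (show 1 < Fintype.card A from hA)
  let X : ℕ → ℝ := fun n => (n : ℝ) ^ (1 / 20 : ℝ)
  have hXtop : Filter.Tendsto X Filter.atTop Filter.atTop :=
    (tendsto_rpow_atTop (by norm_num)).comp tendsto_natCast_atTop_atTop
  have hXpow : ∀ n : ℕ, (n : ℝ) = X n ^ 20 := by
    intro n
    rw [← Real.rpow_natCast, ← Real.rpow_mul (Nat.cast_nonneg n)]
    norm_num
  have hlim : Filter.Tendsto (fun n => 1 - 4 * 8 ^ 40 * ((X n / 8) ^ 40 * Real.exp (-(X n / 8))))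
      Filter.atTop (nhds 1) := by
    have h := (Real.tendsto_pow_mul_exp_neg_atTop_nhds_zero 40).comp
      (hXtop.atTop_div_const (by norm_num : (0 : ℝ) < 8))
    simpa using (h.const_mul (4 * 8 ^ 40)).const_sub 1
  refine tendsto_of_tendsto_of_tendsto_of_le_of_le' hlim tendsto_const_nhds ?_ ?_
  · filter_upwards [hXtop.eventually_ge_atTop 10, Filter.eventually_gt_atTop 0] with n hx hn
    obtain ⟨M, R, hM, hR, hL, hMx, hRx⟩ := exists_parameters (X n) hx n (hXpow n)
    have hbad := card_no_short_sync_word_le a b hab M R ((n - 1) ^ 2) hM hR hL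
    have hsync := card_le_mul_card_isSynchronizing hn a
    set Y := (Finset.univ : Finset (Fin n → A → Fin n)).filter (fun δ => IsSynchronizing δ) with hY
    have hsplit : ((Finset.univ.filter fun δ : Fin n → A → Fin n => IsSynchronizing δ ∧
          ∃ w : List A, w.length ≤ (n - 1) ^ 2 ∧ IsSyncWord δ w).card : ℝ) +
        (Finset.univ.filter fun δ : Fin n → A → Fin n => IsSynchronizing δ ∧
          ¬ ∃ w : List A, w.length ≤ (n - 1) ^ 2 ∧ IsSyncWord δ w).card = Y.card := by
      rw [← Finset.filter_filter, ← Finset.filter_filter, ← hY]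
      exact_mod_cast Finset.card_filter_add_card_filter_not _
    have hcard : 0 < Fintype.card (Fin n → A → Fin n) :=
      Fintype.card_pos_iff.2 ⟨fun q _ => q⟩
    have hY0 : (0 : ℝ) < Y.card := by
      have : 0 < Y.card := Nat.pos_of_ne_zero fun h => by
        rw [h] at hsync
        omega
      exact_mod_cast this
    have hsync' : (Fintype.card (Fin n → A → Fin n) : ℝ) ≤ n * Y.card := by exact_mod_cast hsync
    have he₁ : Real.exp (-(M * (M - 1)) / (2 * n)) ≤ Real.exp (-(X n / 8)) := by
      rw [Real.exp_le_exp, neg_div]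
      linarith
    have he₂ : Real.exp (-(R * (R - 1)) / (2 * M)) ≤ Real.exp (-(X n / 8)) := by
      rw [Real.exp_le_exp, neg_div]
      linarith
    have hbad' : ((Finset.univ.filter fun δ : Fin n → A → Fin n => IsSynchronizing δ ∧
        ¬ ∃ w : List A, w.length ≤ (n - 1) ^ 2 ∧ IsSyncWord δ w).card : ℝ) ≤
        4 * 8 ^ 40 * ((X n / 8) ^ 40 * Real.exp (-(X n / 8))) * Y.card := by
      refine hbad.trans ?_
      calc _ ≤ (2 * n * Real.exp (-(X n / 8)) + 2 * n * Real.exp (-(X n / 8))) *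
            (n * Y.card) := by gcongr
        _ = 4 * (n : ℝ) ^ 2 * Real.exp (-(X n / 8)) * Y.card := by ring
        _ = _ := by
          rw [hXpow n]
          ring
    rw [le_div_iff₀ hY0]
    linarith
  · refine Filter.Eventually.of_forall fun n => div_le_one_of_le₀ ?_ (Nat.cast_nonneg _)
    exact Nat.cast_le.2 (Finset.card_le_card fun δ hδ =>
      Finset.mem_filter.2 ⟨Finset.mem_univ _, (Finset.mem_filter.1 hδ).2.1⟩)
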